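/- arXiv:1607.01311 — 2 statements merged into one kernel-verified Lean document; each statement's English description precedes it below -/
import Mathlib

section
/- For every integer n ≥ 0, the identity B_n(x) = Σ_{k=0}^{n} C(n,k) · N_k(x) · M_{n-k}(x) holds as an identity of polynomials in x, where C(n,k) denotes the binomial coefficient. -/
open scoped Classical
noncomputable section

/-- Number of descents of a permutation of `Fin n`:
indices `i ∈ {1,…,n-1}` (0-based `i` with `i+1 < n`) such that `π i > π (i+1)`. -/
def desA (n : ℕ) (π : Equiv.Perm (Fin n)) : ℕ :=
  (Finset.univ.filter (fun i : Fin n => ∃ h : i.1 + 1 < n, π ⟨i.1 + 1, h⟩ < π i)).card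

/-- Type A Eulerian polynomial `A_n(x) = ∑_{π ∈ S_n} x^{des π}`, with `A_0 = 1`. -/
def eulerianA (n : ℕ) : Polynomial ℚ :=
  ∑ π : Equiv.Perm (Fin n), Polynomial.X ^ desA n π

/-- Perfect matchings of `[2n]`, encoded as fixed-point-free involutions of `Fin (2n)`;
the blocks are the pairs `{i, f i}`. -/
def matchings (n : ℕ) : Finset (Equiv.Perm (Fin (2 * n))) :=
  Finset.univ.filter (fun f => f * f = 1 ∧ ∀ i, f i ≠ i)

/-- `el(M)`: the number of blocks whose larger entry is even.  Index `i : Fin (2n)`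
represents the `1`-based value `i+1`, so "value even" is `i % 2 = 1`. -/
def elM {n : ℕ} (f : Equiv.Perm (Fin (2 * n))) : ℕ :=
  (Finset.univ.filter (fun i : Fin (2 * n) => f i < i ∧ (i : ℕ) % 2 = 1)).card

/-- `ol(M)`: the number of blocks whose larger entry is odd. -/
def olM {n : ℕ} (f : Equiv.Perm (Fin (2 * n))) : ℕ :=
  (Finset.univ.filter (fun i : Fin (2 * n) => f i < i ∧ (i : ℕ) % 2 = 0)).card

/-- `N_n(x) = ∑_M x^{el(M)}` over perfect matchings of `[2n]`. -/
def Npoly (n : ℕ) : Polynomial ℚ := ∑ f ∈ matchings n, Polynomial.X ^ elM f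

/-- `M_n(x) = ∑_M x^{ol(M)}` over perfect matchings of `[2n]`. -/
def Mpoly (n : ℕ) : Polynomial ℚ := ∑ f ∈ matchings n, Polynomial.X ^ olM f

/-- A signed permutation of rank `n` (an element of the hyperoctahedral group `B_n`)
is encoded by an unsigned permutation together with a sign vector; its one-line
form has `i`-th value `±(σ i + 1)`. -/
def svalue {n : ℕ} (π : Equiv.Perm (Fin n) × (Fin n → Bool)) (i : Fin n) : ℤ :=
  (if π.2 i then -1 else 1) * ((π.1 i : ℕ) + 1)

/-- The window `π(0)π(1)⋯π(n)` of a signed permutation, with `π(0) = 0`. -/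
def bval {n : ℕ} (π : Equiv.Perm (Fin n) × (Fin n → Bool)) (i : ℕ) : ℤ :=
  if h : 0 < i ∧ i ≤ n then svalue π ⟨i - 1, by omega⟩ else 0

/-- `des_B(π) = #{i ∈ {0,1,…,n-1} : π(i) > π(i+1)}`, where `π(0) = 0`. -/
def desB {n : ℕ} (π : Equiv.Perm (Fin n) × (Fin n → Bool)) : ℕ :=
  ((Finset.range n).filter (fun i => bval π (i + 1) < bval π i)).card

/-- Type B Eulerian polynomial `B_n(x) = ∑_{π ∈ B_n} x^{des_B π}`, with `B_0 = 1`. -/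
def eulerianB (n : ℕ) : Polynomial ℚ :=
  ∑ π : Equiv.Perm (Fin n) × (Fin n → Bool), Polynomial.X ^ desB π

open Polynomial in
/-- If each exponent `e a` is `d` or `d + 1`, with `D a` indicating the first case, the
generating function of `e` depends only on the number of occurrences of each case. -/
lemma sum_X_pow_of_add_eq {ι : Type*} (s : Finset ι) (e D : ι → ℕ) (d : ℕ)
    (he : ∀ a ∈ s, e a + D a = d + 1) (hD : ∀ a ∈ s, D a ≤ 1) :
    ∑ a ∈ s, (X : ℚ[X]) ^ e a =
      ((∑ a ∈ s, D a : ℕ) : ℚ[X]) * X ^ d + ((s.card : ℚ[X]) - ((∑ a ∈ s, D a : ℕ) : ℚ[X])) * X ^ (d + 1) := by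
  have key : ∀ a ∈ s, (X : ℚ[X]) ^ e a = (D a : ℚ[X]) * X ^ d + (1 - (D a : ℚ[X])) * X ^ (d + 1) := by
    intro a ha
    have h1 := he a ha
    have h2 := hD a ha
    obtain h | h : D a = 0 ∨ D a = 1 := by omega
    · have : e a = d + 1 := by omega
      simp [h, this]
    · have : e a = d := by omega
      simp [h, this]
  rw [Finset.sum_congr rfl key, Finset.sum_add_distrib, ← Finset.sum_mul, ← Finset.sum_mul,
    Finset.sum_sub_distrib]
  simp

open Polynomial in
lemma X_mul_derivative_X_pow (d : ℕ) :
    (X : ℚ[X]) * derivative (X ^ d) = (d : ℚ[X]) * X ^ d := by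
  cases d with
  | zero => simp
  | succ d => simp; ring

section Matchings

variable {N : ℕ}

/-- Extend a permutation of `Fin N` to `Fin (N + 2)` by exchanging the two new elements. -/
def extendSwap (f : Equiv.Perm (Fin N)) : Equiv.Perm (Fin (N + 2)) :=
  finSumFinEquiv.permCongr (Equiv.sumCongr f (Equiv.swap 0 1))

@[simp] lemma extendSwap_castAdd (f : Equiv.Perm (Fin N)) (i : Fin N) :
    extendSwap f (Fin.castAdd 2 i) = Fin.castAdd 2 (f i) := by
  simp [extendSwap, Equiv.permCongr_apply]

@[simp] lemma extendSwap_natAdd_zero (f : Equiv.Perm (Fin N)) :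
    extendSwap f (Fin.natAdd N 0) = Fin.natAdd N 1 := by
  simp only [extendSwap, Equiv.permCongr_apply, finSumFinEquiv_symm_apply_natAdd]
  simp

@[simp] lemma extendSwap_natAdd_one (f : Equiv.Perm (Fin N)) :
    extendSwap f (Fin.natAdd N 1) = Fin.natAdd N 0 := by
  simp only [extendSwap, Equiv.permCongr_apply, finSumFinEquiv_symm_apply_natAdd]
  simp

lemma castAdd_ne_natAdd {m : ℕ} (i : Fin N) (j : Fin m) : Fin.castAdd m i ≠ Fin.natAdd N j := by
  intro h
  have := congrArg Fin.val h
  simp at this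
  omega

lemma natAdd_zero_ne_natAdd_one : (Fin.natAdd N 0 : Fin (N + 2)) ≠ Fin.natAdd N 1 := by
  intro h
  have := congrArg Fin.val h
  simp at this

/-- The possible partners of `Fin.natAdd N 0` in a matching of `Fin (N + 2)`. -/
def partner : Option (Fin N) → Fin (N + 2)
  | none => Fin.natAdd N 1
  | some a => Fin.castAdd 2 a

lemma partner_ne (a : Option (Fin N)) : partner a ≠ Fin.natAdd N 0 := by
  cases a with
  | none => exact natAdd_zero_ne_natAdd_one.symm
  | some a => exact castAdd_ne_natAdd a 0

lemma partner_injective : Function.Injective (partner (N := N)) := by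
  rintro (_ | a) (_ | b) h
  · rfl
  · exact absurd h.symm (castAdd_ne_natAdd b 1)
  · exact absurd h (castAdd_ne_natAdd a 1)
  · exact congrArg some (Fin.castAdd_injective N 2 h)

lemma exists_partner_eq {b : Fin (N + 2)} (hb : b ≠ Fin.natAdd N 0) : ∃ a, partner a = b := by
  induction b using Fin.addCases with
  | left i => exact ⟨some i, rfl⟩
  | right j =>
    fin_cases j
    · exact absurd rfl hb
    · exact ⟨none, rfl⟩

/-- Insert two new elements in a matching `f`, the first of which is matched with `partner a`. -/
def insertPair (f : Equiv.Perm (Fin N)) (a : Option (Fin N)) : Equiv.Perm (Fin (N + 2)) :=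
  Equiv.swap (partner a) (Fin.natAdd N 1) * extendSwap f *
    Equiv.swap (partner a) (Fin.natAdd N 1)

lemma insertPair_natAdd_zero (f : Equiv.Perm (Fin N)) (a : Option (Fin N)) :
    insertPair f a (Fin.natAdd N 0) = partner a := by
  simp only [insertPair, Equiv.Perm.mul_apply]
  rw [Equiv.swap_apply_of_ne_of_ne (partner_ne a).symm natAdd_zero_ne_natAdd_one]
  simp

lemma insertPair_none (f : Equiv.Perm (Fin N)) : insertPair f none = extendSwap f := by
  rw [insertPair, partner, Equiv.swap_self]
  rfl

lemma insertPair_some_natAdd_one (f : Equiv.Perm (Fin N)) {a : Fin N} (ha : f a ≠ a) :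
    insertPair f (some a) (Fin.natAdd N 1) = Fin.castAdd 2 (f a) := by
  simp only [insertPair, partner, Equiv.Perm.mul_apply, Equiv.swap_apply_right, extendSwap_castAdd]
  exact Equiv.swap_apply_of_ne_of_ne (fun h => ha (Fin.castAdd_injective N 2 h))
    (castAdd_ne_natAdd _ _)

lemma insertPair_some_self (f : Equiv.Perm (Fin N)) (a : Fin N) :
    insertPair f (some a) (Fin.castAdd 2 a) = Fin.natAdd N 0 := by
  simp only [insertPair, partner, Equiv.Perm.mul_apply, Equiv.swap_apply_left,
    extendSwap_natAdd_one]
  exact Equiv.swap_apply_of_ne_of_ne (castAdd_ne_natAdd _ _).symm natAdd_zero_ne_natAdd_one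

lemma insertPair_some_castAdd (f : Equiv.Perm (Fin N)) {a i : Fin N} (hi : i ≠ a) :
    insertPair f (some a) (Fin.castAdd 2 i) =
      if f i = a then Fin.natAdd N 1 else Fin.castAdd 2 (f i) := by
  simp only [insertPair, partner, Equiv.Perm.mul_apply]
  rw [Equiv.swap_apply_of_ne_of_ne (fun h => hi (Fin.castAdd_injective N 2 h))
    (castAdd_ne_natAdd _ _), extendSwap_castAdd]
  split_ifs with h
  · rw [h, Equiv.swap_apply_left]
  · exact Equiv.swap_apply_of_ne_of_ne (fun h' => h (Fin.castAdd_injective N 2 h'))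
      (castAdd_ne_natAdd _ _)

/-- Fixed-point-free involutions. -/
def IsMatching {α : Type*} (f : Equiv.Perm α) : Prop := f * f = 1 ∧ ∀ i, f i ≠ i

lemma IsMatching.apply_apply {α : Type*} {f : Equiv.Perm α} (hf : IsMatching f) (i : α) :
    f (f i) = i := by
  rw [← Equiv.Perm.mul_apply, hf.1, Equiv.Perm.one_apply]

lemma IsMatching.swap_conj {α : Type*} [DecidableEq α] {f : Equiv.Perm α} (hf : IsMatching f) (a b : α) :
    IsMatching (Equiv.swap a b * f * Equiv.swap a b) := by
  constructor
  · ext i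
    simp [hf.apply_apply]
  · intro i h
    simp only [Equiv.Perm.mul_apply] at h
    apply hf.2 (Equiv.swap a b i)
    rw [← Equiv.swap_apply_self a b (f _), h]

lemma IsMatching.extendSwap {f : Equiv.Perm (Fin N)} (hf : IsMatching f) :
    IsMatching (extendSwap f) := by
  constructor
  · ext i : 1
    induction i using Fin.addCases with
    | left i => simp [hf.apply_apply]
    | right j =>
      fin_cases j
      · exact (congrArg _ (extendSwap_natAdd_zero f)).trans (extendSwap_natAdd_one f)
      · exact (congrArg _ (extendSwap_natAdd_one f)).trans (extendSwap_natAdd_zero f)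
  · intro i
    induction i using Fin.addCases with
    | left i =>
      rw [extendSwap_castAdd]
      exact fun h => hf.2 i (Fin.castAdd_injective N 2 h)
    | right j =>
      fin_cases j
      · exact fun h => natAdd_zero_ne_natAdd_one ((extendSwap_natAdd_zero f).symm.trans h).symm
      · exact fun h => natAdd_zero_ne_natAdd_one ((extendSwap_natAdd_one f).symm.trans h)

lemma IsMatching.exists_extendSwap_eq {k : Equiv.Perm (Fin (N + 2))} (hk : IsMatching k)
    (h : k (Fin.natAdd N 0) = Fin.natAdd N 1) :
    ∃ f : Equiv.Perm (Fin N), IsMatching f ∧ _root_.extendSwap f = k := by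
  have h' : k (Fin.natAdd N 1) = Fin.natAdd N 0 := by rw [← h, hk.apply_apply]
  have hex : ∀ i : Fin N, ∃ j : Fin N, Fin.castAdd 2 j = k (Fin.castAdd 2 i) := by
    intro i
    obtain ⟨a, ha⟩ := exists_partner_eq (b := k (Fin.castAdd 2 i)) (fun e => by
      rw [← h'] at e
      exact castAdd_ne_natAdd _ _ (k.injective e))
    cases a with
    | none =>
      rw [partner, ← h] at ha
      exact absurd (k.injective ha).symm (castAdd_ne_natAdd _ _)
    | some j => exact ⟨j, ha⟩
  choose g hg using hex
  have hgg : Function.Involutive g := fun i => by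
    apply Fin.castAdd_injective N 2
    rw [hg, hg, hk.apply_apply]
  refine ⟨hgg.toPerm, ⟨?_, ?_⟩, ?_⟩
  · ext i : 1
    simp [hgg i]
  · intro i e
    apply hk.2 (Fin.castAdd 2 i)
    rw [← hg]
    exact congrArg _ e
  · ext i : 1
    induction i using Fin.addCases with
    | left i => rw [extendSwap_castAdd, ← hg]; rfl
    | right j =>
      fin_cases j
      · exact (extendSwap_natAdd_zero _).trans h.symm
      · exact (extendSwap_natAdd_one _).trans h'.symm

lemma extendSwap_injective : Function.Injective (extendSwap (N := N)) := by
  intro f g h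
  ext i : 1
  apply Fin.castAdd_injective N 2
  rw [← extendSwap_castAdd, h, extendSwap_castAdd]

lemma insertPair_injective {f g : Equiv.Perm (Fin N)} {a b : Option (Fin N)}
    (h : insertPair f a = insertPair g b) : f = g ∧ a = b := by
  have hab : a = b := by
    apply partner_injective
    rw [← insertPair_natAdd_zero f, h, insertPair_natAdd_zero]
  subst hab
  exact ⟨extendSwap_injective (mul_left_cancel (mul_right_cancel h)), rfl⟩

lemma IsMatching.exists_insertPair_eq {k : Equiv.Perm (Fin (N + 2))} (hk : IsMatching k) :
    ∃ (f : Equiv.Perm (Fin N)) (a : Option (Fin N)), IsMatching f ∧ insertPair f a = k := by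
  obtain ⟨a, ha⟩ := exists_partner_eq (hk.2 (Fin.natAdd N 0))
  obtain ⟨f, hf, hfk⟩ := (hk.swap_conj (partner a) (Fin.natAdd N 1)).exists_extendSwap_eq (by
    simp only [Equiv.Perm.mul_apply]
    rw [Equiv.swap_apply_of_ne_of_ne (partner_ne a).symm natAdd_zero_ne_natAdd_one, ← ha]
    simp)
  refine ⟨f, a, hf, ?_⟩
  rw [insertPair, hfk]
  ext i
  simp

/-- The indicator that `i` is the larger element of its block and has parity `q`. -/
def closerInd (q : ℕ) (f : Equiv.Perm (Fin N)) (i : Fin N) : ℕ :=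
  if f i < i ∧ (i : ℕ) % 2 = q then 1 else 0

/-- The number of blocks whose larger element has parity `q`. -/
def closers (q : ℕ) (f : Equiv.Perm (Fin N)) : ℕ := ∑ i, closerInd q f i

lemma closers_extendSwap (q : ℕ) (f : Equiv.Perm (Fin N)) :
    closers q (extendSwap f) = closers q f + if (N + 1) % 2 = q then 1 else 0 := by
  simp only [closers, closerInd, Fin.sum_univ_add, Fin.sum_univ_two, extendSwap_castAdd,
    extendSwap_natAdd_zero, extendSwap_natAdd_one, Fin.lt_def, Fin.val_castAdd, Fin.val_natAdd]
  simp

lemma closerInd_add_le_one {f : Equiv.Perm (Fin N)} (hf : IsMatching f) (q : ℕ) (a : Fin N) :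
    closerInd q f a + closerInd q f (f a) ≤ 1 := by
  simp only [closerInd, hf.apply_apply, Fin.lt_def]
  split_ifs <;> omega

lemma closers_insertPair_some {f : Equiv.Perm (Fin N)} (hf : IsMatching f) {q : ℕ} (hq : q < 2)
    (a : Fin N) :
    closers q (insertPair f (some a)) + (closerInd q f a + closerInd q f (f a)) =
      closers q f + 1 := by
  have old : ∀ i : Fin N, closerInd q f i =
      closerInd q (insertPair f (some a)) (Fin.castAdd 2 i) +
        (if i = a then closerInd q f a else 0) + (if i = f a then closerInd q f (f a) else 0) := by
    intro i
    by_cases hi : i = a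
    · subst hi
      have : i ≠ f i := (hf.2 i).symm
      have h0 : closerInd q (insertPair f (some i)) (Fin.castAdd 2 i) = 0 := by
        simp only [closerInd, insertPair_some_self, Fin.lt_def, Fin.val_castAdd, Fin.val_natAdd]
        rw [if_neg (by omega)]
      simp [h0, this]
    · by_cases hfi : f i = a
      · have hia : i = f a := by rw [← hfi, hf.apply_apply]
        have h0 : closerInd q (insertPair f (some a)) (Fin.castAdd 2 i) = 0 := by
          rw [closerInd, insertPair_some_castAdd f hi, if_pos hfi]
          simp only [Fin.lt_def, Fin.val_castAdd, Fin.val_natAdd]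
          rw [if_neg (by omega)]
        rw [h0, if_neg hi, if_pos hia, hia]
        simp
      · have hia : i ≠ f a := fun h => hfi (by rw [h, hf.apply_apply])
        rw [if_neg hi, if_neg hia]
        simp only [closerInd, insertPair_some_castAdd f hi, if_neg hfi, Fin.lt_def,
          Fin.val_castAdd, add_zero]
  have new : closerInd q (insertPair f (some a)) (Fin.natAdd N 0) +
      closerInd q (insertPair f (some a)) (Fin.natAdd N 1) = 1 := by
    simp only [closerInd, insertPair_natAdd_zero, insertPair_some_natAdd_one f (hf.2 a), partner,
      Fin.lt_def, Fin.val_castAdd, Fin.val_natAdd]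
    have := a.2
    have := (f a).2
    simp
    split_ifs <;> omega
  have sumOld : closers q f = ∑ i, closerInd q (insertPair f (some a)) (Fin.castAdd 2 i) +
      (closerInd q f a + closerInd q f (f a)) := by
    rw [closers, Finset.sum_congr rfl fun i _ => old i, Finset.sum_add_distrib,
      Finset.sum_add_distrib]
    simp [add_assoc]
  rw [sumOld, closers, Fin.sum_univ_add, Fin.sum_univ_two]
  omega

lemma sum_closerInd_add (q : ℕ) (f : Equiv.Perm (Fin N)) :
    ∑ a, (closerInd q f a + closerInd q f (f a)) = 2 * closers q f := by
  rw [Finset.sum_add_distrib, Equiv.sum_comp f (closerInd q f), closers]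
  ring

open Polynomial in
/-- The generating polynomial of matchings by the number of closers of parity `q`. -/
def matchingPoly (q N : ℕ) : ℚ[X] :=
  ∑ f ∈ Finset.univ.filter (fun f : Equiv.Perm (Fin N) => IsMatching f), X ^ closers q f

open Polynomial in
lemma matchingPoly_add_two {q : ℕ} (hq : q < 2) (N : ℕ) :
    matchingPoly q (N + 2) =
      (X ^ (if (N + 1) % 2 = q then 1 else 0) + (N : ℚ[X]) * X) * matchingPoly q N +
        2 * X * (1 - X) * derivative (matchingPoly q N) := by
  have hbij : matchingPoly q (N + 2) =
      ∑ f ∈ Finset.univ.filter (fun f : Equiv.Perm (Fin N) => IsMatching f),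
        ∑ a : Option (Fin N), (X : ℚ[X]) ^ closers q (insertPair f a) := by
    rw [← Finset.sum_product', matchingPoly]
    symm
    apply Finset.sum_bij (fun p _ => insertPair p.1 p.2)
    · rintro ⟨f, a⟩ h
      simp only [Finset.mem_product, Finset.mem_filter, Finset.mem_univ, true_and,
        and_true] at h ⊢
      exact h.extendSwap.swap_conj _ _
    · rintro ⟨f, a⟩ _ ⟨g, b⟩ _ h
      obtain ⟨rfl, rfl⟩ := insertPair_injective h
      rfl
    · intro k hk
      obtain ⟨f, a, hf, h⟩ := (Finset.mem_filter.1 hk).2.exists_insertPair_eq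
      exact ⟨(f, a), by simp [hf], h⟩
    · intros
      rfl
  rw [hbij, matchingPoly, derivative_sum, Finset.mul_sum, Finset.mul_sum,
    ← Finset.sum_add_distrib]
  refine Finset.sum_congr rfl fun f hf => ?_
  have hf := (Finset.mem_filter.1 hf).2
  rw [Fintype.sum_option, insertPair_none, closers_extendSwap,
    sum_X_pow_of_add_eq Finset.univ _ (fun a => closerInd q f a + closerInd q f (f a))
      (closers q f) (fun a _ => closers_insertPair_some hf hq a)
      (fun a _ => closerInd_add_le_one hf q a), sum_closerInd_add]
  have hX := X_mul_derivative_X_pow (closers q f)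
  rw [Finset.card_univ, Fintype.card_fin, pow_add, pow_succ]
  push_cast
  linear_combination (-2 * (1 - X)) * hX

end Matchings

lemma Npoly_eq_matchingPoly (n : ℕ) : Npoly n = matchingPoly 1 (2 * n) := by
  refine Finset.sum_congr ?_ fun f _ => ?_
  · ext f
    rw [matchings, Finset.mem_filter, Finset.mem_filter, IsMatching]
  · simp only [elM, closers, closerInd, Finset.card_filter]

lemma Mpoly_eq_matchingPoly (n : ℕ) : Mpoly n = matchingPoly 0 (2 * n) := by
  refine Finset.sum_congr ?_ fun f _ => ?_
  · ext f
    rw [matchings, Finset.mem_filter, Finset.mem_filter, IsMatching]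
  · simp only [olM, closers, closerInd, Finset.card_filter]

open Polynomial in
lemma Npoly_succ (n : ℕ) :
    Npoly (n + 1) = (2 * (n : ℚ[X]) + 1) * X * Npoly n +
      2 * X * (1 - X) * derivative (Npoly n) := by
  rw [Npoly_eq_matchingPoly, Npoly_eq_matchingPoly, mul_add, matchingPoly_add_two (by norm_num),
    if_pos (by omega)]
  push_cast
  ring

open Polynomial in
lemma Mpoly_succ (n : ℕ) :
    Mpoly (n + 1) = (2 * (n : ℚ[X]) * X + 1) * Mpoly n +
      2 * X * (1 - X) * derivative (Mpoly n) := by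
  rw [Mpoly_eq_matchingPoly, Mpoly_eq_matchingPoly, mul_add, matchingPoly_add_two (by norm_num),
    if_neg (by omega)]
  push_cast
  ring

section SignedPermutations

variable {n : ℕ}

/-- Insert the letter `±(n + 1)` at position `p` in a signed permutation of rank `n`. -/
def insertLargest (p : Fin (n + 1)) (s : Bool) (π : Equiv.Perm (Fin n) × (Fin n → Bool)) :
    Equiv.Perm (Fin (n + 1)) × (Fin (n + 1) → Bool) :=
  ((finSuccEquiv' p).trans ((Equiv.optionCongr π.1).trans (finSuccEquiv' (Fin.last n)).symm),
    p.insertNth s π.2)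

lemma insertLargest_fst_self (p : Fin (n + 1)) (s : Bool)
    (π : Equiv.Perm (Fin n) × (Fin n → Bool)) :
    (insertLargest p s π).1 p = Fin.last n := by
  simp [insertLargest]

lemma insertLargest_fst_succAbove (p : Fin (n + 1)) (s : Bool)
    (π : Equiv.Perm (Fin n) × (Fin n → Bool)) (i : Fin n) :
    (insertLargest p s π).1 (p.succAbove i) = (π.1 i).castSucc := by
  simp [insertLargest]

lemma insertLargest_bijective :
    Function.Bijective
      (fun x : (Fin (n + 1) × Bool) × (Equiv.Perm (Fin n) × (Fin n → Bool)) =>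
        insertLargest x.1.1 x.1.2 x.2) := by
  rw [Fintype.bijective_iff_injective_and_card]
  constructor
  · rintro ⟨⟨p, s⟩, π⟩ ⟨⟨q, t⟩, τ⟩ h
    simp only at h
    have hp : p = q := by
      apply (insertLargest p s π).1.injective
      rw [insertLargest_fst_self, h, insertLargest_fst_self]
    subst hp
    have h2 := congrArg Prod.snd h
    simp only [insertLargest, Fin.insertNth_inj] at h2
    obtain ⟨rfl, hs⟩ := h2
    have h1 : π.1 = τ.1 := by
      ext i : 1
      apply Fin.castSucc_injective
      rw [← insertLargest_fst_succAbove p s, h, insertLargest_fst_succAbove]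
    rw [Prod.ext h1 hs]
  · simp [Fintype.card_perm, Nat.factorial_succ, pow_succ]
    ring

lemma svalue_insertLargest_self (p : Fin (n + 1)) (s : Bool)
    (π : Equiv.Perm (Fin n) × (Fin n → Bool)) :
    svalue (insertLargest p s π) p = (if s then -1 else 1) * ((n : ℤ) + 1) := by
  rw [svalue, insertLargest_fst_self]
  simp [insertLargest]

lemma svalue_insertLargest_succAbove (p : Fin (n + 1)) (s : Bool)
    (π : Equiv.Perm (Fin n) × (Fin n → Bool)) (i : Fin n) :
    svalue (insertLargest p s π) (p.succAbove i) = svalue π i := by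
  rw [svalue, insertLargest_fst_succAbove]
  simp [insertLargest, svalue]

lemma bval_insertLargest_of_le (p : Fin (n + 1)) (s : Bool)
    (π : Equiv.Perm (Fin n) × (Fin n → Bool)) {i : ℕ} (hi : i ≤ p) :
    bval (insertLargest p s π) i = bval π i := by
  have hp := p.2
  by_cases h0 : 0 < i
  · rw [bval, bval, dif_pos ⟨h0, by omega⟩, dif_pos ⟨h0, by omega⟩,
      ← svalue_insertLargest_succAbove p s]
    congr 1
    rw [Fin.succAbove_of_castSucc_lt]
    · rfl
    · simp only [Fin.lt_def, Fin.val_castSucc]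
      omega
  · rw [bval, bval, dif_neg (by omega), dif_neg (by omega)]

lemma bval_insertLargest_self (p : Fin (n + 1)) (s : Bool)
    (π : Equiv.Perm (Fin n) × (Fin n → Bool)) :
    bval (insertLargest p s π) (p + 1) = (if s then -1 else 1) * ((n : ℤ) + 1) := by
  have hp := p.2
  rw [bval, dif_pos ⟨by omega, by omega⟩, ← svalue_insertLargest_self p s π]
  rfl

lemma bval_insertLargest_of_lt (p : Fin (n + 1)) (s : Bool)
    (π : Equiv.Perm (Fin n) × (Fin n → Bool)) {i : ℕ} (hi : (p : ℕ) < i) (hn : i ≤ n) :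
    bval (insertLargest p s π) (i + 1) = bval π i := by
  rw [bval, bval, dif_pos ⟨by omega, by omega⟩, dif_pos ⟨by omega, by omega⟩,
    ← svalue_insertLargest_succAbove p s]
  congr 1
  rw [Fin.succAbove_of_le_castSucc]
  · ext
    simp
    omega
  · simp only [Fin.le_def, Fin.val_castSucc]
    omega

lemma abs_bval_lt (π : Equiv.Perm (Fin n) × (Fin n → Bool)) (i : ℕ) :
    |bval π i| < (n : ℤ) + 1 := by
  rw [bval]
  split_ifs with h
  · have := (π.1 ⟨i - 1, by omega⟩).2
    rw [svalue, abs_lt]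
    split_ifs <;> constructor <;> omega
  · rw [abs_zero]
    omega

/-- The indicator of a type B descent at `i`. -/
def descInd (π : Equiv.Perm (Fin n) × (Fin n → Bool)) (i : ℕ) : ℕ :=
  if bval π (i + 1) < bval π i then 1 else 0

lemma desB_eq_sum_descInd (π : Equiv.Perm (Fin n) × (Fin n → Bool)) :
    desB π = ∑ i ∈ Finset.range n, descInd π i := by
  simp only [desB, descInd, Finset.card_filter]

lemma sum_descInd_insertLargest (p : Fin (n + 1)) (s : Bool)
    (π : Equiv.Perm (Fin n) × (Fin n → Bool)) :
    ∑ i ∈ Finset.range p, descInd (insertLargest p s π) i =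
      ∑ i ∈ Finset.range p, descInd π i := by
  refine Finset.sum_congr rfl fun i hi => ?_
  rw [Finset.mem_range] at hi
  rw [descInd, descInd, bval_insertLargest_of_le p s π (by omega : i + 1 ≤ p),
    bval_insertLargest_of_le p s π (by omega : i ≤ p)]

lemma descInd_insertLargest_self (p : Fin (n + 1)) (s : Bool)
    (π : Equiv.Perm (Fin n) × (Fin n → Bool)) :
    descInd (insertLargest p s π) p = if s then 1 else 0 := by
  rw [descInd, bval_insertLargest_self, bval_insertLargest_of_le p s π le_rfl]
  have := abs_lt.1 (abs_bval_lt π p)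
  cases s <;> simp <;> omega

lemma descInd_insertLargest_succ (p : Fin (n + 1)) (s : Bool)
    (π : Equiv.Perm (Fin n) × (Fin n → Bool)) (hp : (p : ℕ) < n) :
    descInd (insertLargest p s π) (p + 1) = if s then 0 else 1 := by
  rw [descInd, bval_insertLargest_self,
    bval_insertLargest_of_lt p s π (Nat.lt_succ_self p) (by omega)]
  have := abs_lt.1 (abs_bval_lt π (p + 1))
  cases s <;> simp <;> omega

lemma desB_insertLargest_last (s : Bool) (π : Equiv.Perm (Fin n) × (Fin n → Bool)) :
    desB (insertLargest (Fin.last n) s π) = desB π + if s then 1 else 0 := by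
  have h1 := sum_descInd_insertLargest (Fin.last n) s π
  have h2 := descInd_insertLargest_self (Fin.last n) s π
  rw [Fin.val_last] at h1 h2
  rw [desB_eq_sum_descInd, desB_eq_sum_descInd, Finset.sum_range_succ, h1, h2]

lemma desB_insertLargest_castSucc (p : Fin n) (s : Bool)
    (π : Equiv.Perm (Fin n) × (Fin n → Bool)) :
    desB (insertLargest p.castSucc s π) + descInd π p = desB π + 1 := by
  have hp := p.2
  obtain ⟨m, hm⟩ : ∃ m, n = p + 1 + m := ⟨n - (p + 1), by omega⟩
  have h1 := sum_descInd_insertLargest p.castSucc s π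
  have h2 := descInd_insertLargest_self p.castSucc s π
  have h3 := descInd_insertLargest_succ p.castSucc s π hp
  rw [Fin.val_castSucc] at h1 h2 h3
  have h4 : ∑ i ∈ Finset.range m, descInd (insertLargest p.castSucc s π) (p + 2 + i) =
      ∑ i ∈ Finset.range m, descInd π (p + 1 + i) := by
    refine Finset.sum_congr rfl fun i hi => ?_
    rw [Finset.mem_range] at hi
    rw [descInd, descInd, show (p : ℕ) + 2 + i = p + 1 + i + 1 by ring,
      bval_insertLargest_of_lt p.castSucc s π (by simp; omega) (by omega),
      bval_insertLargest_of_lt p.castSucc s π (by simp; omega) (by omega)]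
  have e1 : Finset.range (n + 1) = Finset.range (p + 2 + m) := by congr 1; omega
  have e2 : Finset.range n = Finset.range (p + 1 + m) := by congr 1
  rw [desB_eq_sum_descInd, desB_eq_sum_descInd, e1, e2, Finset.sum_range_add _ ((p : ℕ) + 2),
    Finset.sum_range_add _ ((p : ℕ) + 1), Finset.sum_range_succ _ ((p : ℕ) + 1),
    Finset.sum_range_succ _ (p : ℕ), Finset.sum_range_succ _ (p : ℕ), h1, h2, h3, h4]
  cases s <;> simp <;> ring

end SignedPermutations

open Polynomial in
lemma eulerianB_succ (n : ℕ) :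
    eulerianB (n + 1) = ((2 * (n : ℚ[X]) + 1) * X + 1) * eulerianB n +
      2 * X * (1 - X) * derivative (eulerianB n) := by
  rw [eulerianB, ← insertLargest_bijective.sum_comp, Fintype.sum_prod_type_right, eulerianB,
    derivative_sum, Finset.mul_sum, Finset.mul_sum, ← Finset.sum_add_distrib]
  refine Finset.sum_congr rfl fun π _ => ?_
  have hs (s : Bool) : ∑ p : Fin n, (X : ℚ[X]) ^ desB (insertLargest p.castSucc s π) =
      (desB π : ℚ[X]) * X ^ desB π + ((n : ℚ[X]) - (desB π : ℚ[X])) * X ^ (desB π + 1) := by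
    rw [sum_X_pow_of_add_eq Finset.univ _ (fun p : Fin n => descInd π p) (desB π)
      (fun p _ => desB_insertLargest_castSucc p s π)
      (fun p _ => by rw [descInd]; split_ifs <;> omega),
      Fin.sum_univ_eq_sum_range (descInd π), ← desB_eq_sum_descInd]
    simp
  rw [Fintype.sum_prod_type_right, Fintype.sum_bool, Fin.sum_univ_castSucc, Fin.sum_univ_castSucc]
  simp only [hs, desB_insertLargest_last]
  have hX := X_mul_derivative_X_pow (desB π)
  simp only [if_true, Bool.false_eq_true, if_false, add_zero, pow_succ]
  linear_combination (-2 * (1 - X)) * hX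

open Polynomial in
lemma sum_choose_mul_succ (F G : ℕ → ℚ[X]) (n : ℕ) :
    ∑ k ∈ Finset.range (n + 2), ((n + 1).choose k : ℚ[X]) * F k * G (n + 1 - k) =
      ∑ k ∈ Finset.range (n + 1),
        (n.choose k : ℚ[X]) * (F (k + 1) * G (n - k) + F k * G (n - k + 1)) := by
  simp only [mul_assoc]
  rw [Finset.sum_choose_succ_mul (fun i j => F i * G j) n, ← Finset.sum_add_distrib]
  refine Finset.sum_congr rfl fun k hk => ?_
  rw [Finset.mem_range] at hk
  rw [show n + 1 - k = n - k + 1 by omega]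
  ring

/-- For every `n ≥ 0`:  `B_n(x) = ∑_{k=0}^n C(n,k) N_k(x) M_{n-k}(x)`. -/
theorem stmt1 (n : ℕ) :
    eulerianB n =
      ∑ k ∈ Finset.range (n + 1), (n.choose k : Polynomial ℚ) * Npoly k * Mpoly (n - k) := by
  induction n with
  | zero =>
    simp [eulerianB, desB, Npoly_eq_matchingPoly, Mpoly_eq_matchingPoly, matchingPoly, closers,
      IsMatching, Finset.filter_true_of_mem]
  | succ n ih =>
    rw [eulerianB_succ, ih, sum_choose_mul_succ, Polynomial.derivative_sum, Finset.mul_sum,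
      Finset.mul_sum, ← Finset.sum_add_distrib]
    refine Finset.sum_congr rfl fun k hk => ?_
    have hk : k ≤ n := Nat.lt_succ_iff.1 (Finset.mem_range.1 hk)
    rw [Npoly_succ, Mpoly_succ, Nat.cast_sub hk]
    simp only [Polynomial.derivative_mul, Polynomial.derivative_natCast]
    ring
end
end

section
/- For every integer n ≥ 1, C_n(x) = Σ_{π ∈ Q_n^2} x^{casc(π)+1} as polynomials in x; that is, for every k ≥ 1 the number of Stirling permutations of the second kind of order n with exactly k − 1 cycle ascents equals the number of Stirling permutations of order n with exactly k descents. -/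
open scoped Classical
noncomputable section

/-- The multiset `{1,1,2,2,…,n,n}` as a list. -/
def baseList (n : ℕ) : List ℕ := (List.range n).flatMap (fun i => [i + 1, i + 1])

/-- A word is Stirling if whenever the same value occurs at positions `i < k`,
every entry strictly between them is greater than that value. -/
def IsStirlingWord (l : List ℕ) : Prop :=
  ∀ i j k : Fin l.length, i < j → j < k → l.get i = l.get k → l.get i < l.get j

/-- The set `Q_n` of Stirling permutations of order `n`:  rearrangements of the
multiset `{1,1,2,2,…,n,n}` in which all entries between the two occurrences of any
value exceed that value. -/
def stirlingPerms (n : ℕ) : Finset (List ℕ) :=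
  ((baseList n).permutations.toFinset).filter IsStirlingWord

/-- Number of descents of `σ ∈ Q_n`: indices `i ∈ {1,…,2n}` (here 0-based) with
`σ_i > σ_{i+1}`, with the convention `σ_{2n+1} = 0`. -/
def desList (l : List ℕ) : ℕ :=
  ((Finset.range l.length).filter (fun i => l.getD (i + 1) 0 < l.getD i 0)).card

/-- The second-order Eulerian polynomial `C_n(x) = ∑_{σ ∈ Q_n} x^{des σ}`. -/
def Cpoly (n : ℕ) : Polynomial ℚ :=
  ∑ σ ∈ stirlingPerms n, Polynomial.X ^ desList σ

/-- A list of cycles is a valid standard cycle form of a Stirling permutation of the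
second kind of order `n` if:  the cycles are disjoint and together use each of
`1,1,2,2,…,n,n` exactly once; both copies of any value lie in the same cycle; each
cycle starts with (one of) its smallest entries; the cycles are listed in increasing
order of their smallest (first) entries; and the word of each cycle reduces to a
Stirling permutation. -/
def IsStirling2 (n : ℕ) (c : List (List ℕ)) : Prop :=
  c.flatten.Perm (baseList n) ∧
  (∀ w ∈ c, w ≠ [] ∧ (∀ v ∈ w, w.count v = 2) ∧ (∀ v ∈ w, w.headI ≤ v) ∧
      IsStirlingWord w) ∧
  c.Chain' (fun w₁ w₂ => w₁.headI < w₂.headI)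

/-- The set `Q_n²` of Stirling permutations of the second kind of order `n`,
each recorded as its standard cycle form (a list of cycles). -/
def stirling2 (n : ℕ) : Finset (List (List ℕ)) :=
  ((((baseList n).permutations.toFinset) ×ˢ (Finset.univ : Finset (Composition (2 * n)))).image
      (fun p => p.1.splitWrtComposition p.2)).filter (IsStirling2 n)

/-- `cyc(σ)`: the number of cycles. -/
def cyc (c : List (List ℕ)) : ℕ := c.length

/-- `cplat(σ)`: the number of cycle plateaus, i.e. entries `c_i` of a cycle
`(c_1,…,c_{2k})` with `c_i = c_{i+1}`, `1 ≤ i < 2k`. -/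
def cplat (c : List (List ℕ)) : ℕ :=
  (c.map (fun w => ((Finset.range w.length).filter
    (fun i => i + 1 < w.length ∧ w.getD i 0 = w.getD (i + 1) 0)).card)).sum

/-- `casc(σ)`: the number of cycle ascents, i.e. entries `c_i` of a cycle
`(c_1,…,c_{2k})` with `c_i < c_{i+1}`, `1 ≤ i < 2k`. -/
def casc (c : List (List ℕ)) : ℕ :=
  (c.map (fun w => ((Finset.range w.length).filter
    (fun i => i + 1 < w.length ∧ w.getD i 0 < w.getD (i + 1) 0)).card)).sum

/-- `cap(σ)`: the number of cycle ascent plateaus, i.e. entries `c_i` of a cycle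
`(c_1,…,c_{2k})` with `c_{i-1} < c_i = c_{i+1}`, `2 ≤ i ≤ 2k-1`. -/
def capSt (c : List (List ℕ)) : ℕ :=
  (c.map (fun w => ((Finset.range w.length).filter
    (fun i => 0 < i ∧ i + 1 < w.length ∧
      w.getD (i - 1) 0 < w.getD i 0 ∧ w.getD i 0 = w.getD (i + 1) 0)).card)).sum

/-- `fix(σ)`: the number of fixed points, i.e. values `k` with `(k,k)` a cycle of `σ`. -/
def fixSt (c : List (List ℕ)) : ℕ :=
  ((Finset.range c.length).filter (fun i => ∃ k : ℕ, c.getD i [] = [k, k])).card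

theorem isStirlingWord_iff_sublist (l : List ℕ) :
    IsStirlingWord l ↔ ∀ a b, [a, b, a].Sublist l → a < b := by
  constructor
  · intro h a b hs
    obtain ⟨f, hf⟩ := List.sublist_iff_exists_fin_orderEmbedding_get_eq.1 hs
    have h0 := hf ⟨0, by simp⟩
    have h1 := hf ⟨1, by simp⟩
    have h2 := hf ⟨2, by simp⟩
    simp only [List.get_eq_getElem, List.getElem_cons_zero, List.getElem_cons_succ] at h0 h1 h2
    have := h (f ⟨0, by simp⟩) (f ⟨1, by simp⟩) (f ⟨2, by simp⟩)
      (f.strictMono (by simp)) (f.strictMono (by simp))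
      (by simp only [List.get_eq_getElem]; rw [← h0, ← h2])
    simp only [List.get_eq_getElem] at this
    rwa [← h0, ← h1] at this
  · intro h i j k hij hjk hik
    apply h
    have hs : ([l.get i, l.get j, l.get k]).Sublist l :=
      List.map_getElem_sublist (is := [i, j, k]) (by
        simp only [List.pairwise_cons, List.mem_cons, List.not_mem_nil, or_false]
        refine ⟨?_, ?_, by simp, by simp⟩
        · rintro a (rfl | rfl)
          exacts [hij, hij.trans hjk]
        · rintro a rfl
          exact hjk)
    rwa [← hik] at hs

theorem IsStirlingWord.sublist {l l' : List ℕ} (h : IsStirlingWord l) (hs : l'.Sublist l) :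
    IsStirlingWord l' := by
  rw [isStirlingWord_iff_sublist] at h ⊢
  exact fun a b hab => h a b (hab.trans hs)

theorem IsStirlingWord.reverse {l : List ℕ} (h : IsStirlingWord l) :
    IsStirlingWord l.reverse := by
  rw [isStirlingWord_iff_sublist] at h ⊢
  intro a b hab
  exact h a b (by simpa using hab.reverse)

theorem IsStirlingWord.append {l₁ l₂ : List ℕ} (h₁ : IsStirlingWord l₁)
    (h₂ : IsStirlingWord l₂) (hd : ∀ v ∈ l₁, v ∉ l₂) : IsStirlingWord (l₁ ++ l₂) := by
  rw [isStirlingWord_iff_sublist] at h₁ h₂ ⊢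
  intro a b hab
  obtain ⟨s, t, hst, hs, ht⟩ := List.sublist_append_iff.1 hab
  by_cases ha : a ∈ l₁
  · have hnt : a ∉ t := fun h => hd a ha (ht.subset h)
    match s, hst with
    | [], hst => simp at hst; simp [← hst] at hnt
    | [_], hst => simp at hst; simp [← hst.2] at hnt
    | [_, _], hst => simp at hst; simp [← hst.2.2] at hnt
    | x :: y :: z :: s, hst =>
      simp only [List.cons_append, List.cons.injEq, List.nil_eq, List.append_eq_nil_iff] at hst
      obtain ⟨rfl, rfl, rfl, rfl, rfl⟩ := hst
      exact h₁ _ _ hs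
  · have hns : a ∉ s := fun h => ha (hs.subset h)
    match s, hst with
    | [], hst => exact h₂ a b (by rw [hst]; exact ht)
    | x :: s, hst => simp at hst; simp [hst.1] at hns

theorem desList_cons (a : ℕ) (l : List ℕ) :
    desList (a :: l) = (if l.headI < a then 1 else 0) + desList l := by
  unfold desList
  rw [Finset.card_filter, Finset.card_filter, List.length_cons, Finset.sum_range_succ', add_comm]
  cases l <;> simp <;> congr

/-- The number of ascents of a word. -/
def ascList (w : List ℕ) : ℕ :=
  ((Finset.range w.length).filter
    (fun i => i + 1 < w.length ∧ w.getD i 0 < w.getD (i + 1) 0)).card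

theorem ascList_cons (a : ℕ) (l : List ℕ) :
    ascList (a :: l) = (if a < l.headI then 1 else 0) + ascList l := by
  unfold ascList
  rw [Finset.card_filter, Finset.card_filter, List.length_cons, Finset.sum_range_succ', add_comm]
  cases l <;> simp
  congr

theorem desList_reverse_append (w r : List ℕ) :
    desList (w.reverse ++ r) =
      ascList w + (if r.headI < w.headI then 1 else 0) + desList r := by
  induction w generalizing r with
  | nil => simp [ascList]
  | cons a l ih =>
    rw [List.reverse_cons, List.append_assoc, List.singleton_append, ih, desList_cons,
      ascList_cons]
    change ascList l + (if a < l.headI then 1 else 0) +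
      ((if r.headI < a then 1 else 0) + desList r) =
      (if a < l.headI then 1 else 0) + ascList l + (if r.headI < a then 1 else 0) + desList r
    ring

/-- The concatenation of the reversed cycles. -/
def reversedCycleWord (c : List (List ℕ)) : List ℕ := (c.map List.reverse).flatten

@[simp] theorem reversedCycleWord_cons (w : List ℕ) (c : List (List ℕ)) :
    reversedCycleWord (w :: c) = w.reverse ++ reversedCycleWord c := rfl

theorem reversedCycleWord_perm (c : List (List ℕ)) :
    (reversedCycleWord c).Perm c.flatten := by
  induction c with
  | nil => exact List.Perm.refl _
  | cons w c ih => exact w.reverse_perm.append ih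

/-- Every cycle starts with its smallest entry and these entries increase along the list. -/
def IsStandardForm (c : List (List ℕ)) : Prop :=
  (∀ w ∈ c, w ≠ [] ∧ ∀ v ∈ w, w.headI ≤ v) ∧ c.Pairwise (fun w₁ w₂ => w₁.headI < w₂.headI)

theorem IsStandardForm.tail {w : List ℕ} {c : List (List ℕ)} (h : IsStandardForm (w :: c)) :
    IsStandardForm c :=
  ⟨fun u hu => h.1 u (List.mem_cons_of_mem _ hu), (List.pairwise_cons.1 h.2).2⟩

theorem IsStandardForm.head_lt {w : List ℕ} {c : List (List ℕ)} (h : IsStandardForm (w :: c))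
    {v : ℕ} (hv : v ∈ reversedCycleWord c) : w.headI < v := by
  obtain ⟨u, hu, hvu⟩ := List.mem_flatten.1 ((reversedCycleWord_perm c).mem_iff.1 hv)
  exact ((List.pairwise_cons.1 h.2).1 u hu).trans_le
    ((h.1 u (List.mem_cons_of_mem _ hu)).2 v hvu)

theorem IsStandardForm.exists_cons {w : List ℕ} {c : List (List ℕ)}
    (h : IsStandardForm (w :: c)) : ∃ a l, w = a :: l :=
  List.exists_cons_of_ne_nil (h.1 w List.mem_cons_self).1

theorem IsStandardForm.head_le {w : List ℕ} {c : List (List ℕ)} (h : IsStandardForm (w :: c))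
    {v : ℕ} (hv : v ∈ reversedCycleWord (w :: c)) : w.headI ≤ v := by
  rcases List.mem_append.1 hv with hv | hv
  · exact (h.1 w List.mem_cons_self).2 v (List.mem_reverse.1 hv)
  · exact (h.head_lt hv).le

theorem IsStandardForm.head_mem {w : List ℕ} {c : List (List ℕ)} (h : IsStandardForm (w :: c)) :
    w.headI ∈ reversedCycleWord (w :: c) := by
  obtain ⟨a, l, rfl⟩ := h.exists_cons
  simp

theorem desList_reversedCycleWord {c : List (List ℕ)} (h : IsStandardForm c)
    (hpos : ∀ v ∈ reversedCycleWord c, 0 < v) :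
    desList (reversedCycleWord c) = casc c + if c = [] then 0 else 1 := by
  induction c with
  | nil => simp [reversedCycleWord, desList, casc]
  | cons w c ih =>
    have hcasc : casc (w :: c) = ascList w + casc c := by simp [casc, ascList]
    rw [reversedCycleWord_cons, desList_reverse_append, hcasc,
      ih h.tail fun v hv => hpos v (List.mem_append_right _ hv)]
    cases c with
    | nil =>
      have : (reversedCycleWord []).headI < w.headI := hpos _ h.head_mem
      rw [if_pos this, if_pos rfl, if_neg (List.cons_ne_nil _ _)]
      ring
    | cons u c =>
      have hlt : ¬ (reversedCycleWord (u :: c)).headI < w.headI := by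
        obtain ⟨b, l, hb⟩ := List.exists_cons_of_ne_nil
          (List.ne_nil_of_mem h.tail.head_mem)
        have := h.head_lt (v := b) (by simp [hb])
        simp only [hb, List.headI_cons]
        omega
      rw [if_neg hlt, if_neg (List.cons_ne_nil _ _), if_neg (List.cons_ne_nil _ _)]
      ring

theorem eq_nil_of_append_eq {w u t : List ℕ} {c : List (List ℕ)} (hu : IsStandardForm (u :: c))
    (hwu : w.headI = u.headI) (hw : w ≠ []) (h : w.reverse = u.reverse ++ t)
    (ht : ∀ v ∈ t, v ∈ reversedCycleWord c) : t = [] := by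
  rcases List.eq_nil_or_concat t with rfl | ⟨s, b, rfl⟩
  · rfl
  · obtain ⟨a, l, rfl⟩ := List.exists_cons_of_ne_nil hw
    have hab : a = b := by
      rw [List.reverse_cons, List.concat_eq_append, ← List.append_assoc] at h
      exact List.singleton_injective (List.append_inj_right' h rfl)
    have := hu.head_lt (ht b (by simp))
    simp only [List.headI_cons] at hwu
    omega

theorem reversedCycleWord_injOn {c c' : List (List ℕ)} (h : IsStandardForm c)
    (h' : IsStandardForm c') (heq : reversedCycleWord c = reversedCycleWord c') : c = c' := by
  induction c generalizing c' with
  | nil =>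
    cases c' with
    | nil => rfl
    | cons u c' => exact absurd (heq ▸ h'.head_mem) (by simp [reversedCycleWord])
  | cons w c ih =>
    cases c' with
    | nil => exact absurd (heq ▸ h.head_mem) (by simp [reversedCycleWord])
    | cons u c' =>
      have hm : w.headI = u.headI :=
        le_antisymm (h.head_le (heq ▸ h'.head_mem)) (h'.head_le (heq ▸ h.head_mem))
      have hw := (h.1 w List.mem_cons_self).1
      have hu := (h'.1 u List.mem_cons_self).1
      rw [reversedCycleWord_cons, reversedCycleWord_cons] at heq
      have key : w.reverse = u.reverse := by
        rcases List.append_eq_append_iff.1 heq with ⟨t, ht, ht'⟩ | ⟨t, ht, ht'⟩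
        · have := eq_nil_of_append_eq h hm.symm hu ht fun v hv => by
            rw [ht']; exact List.mem_append_left _ hv
          simp [ht, this]
        · have := eq_nil_of_append_eq h' hm hw ht fun v hv => by
            rw [ht']; exact List.mem_append_left _ hv
          simp [ht, this]
      rw [key] at heq
      rw [List.reverse_injective key, ih h.tail h'.tail (List.append_cancel_left heq)]

theorem isStirlingWord_reversedCycleWord {c : List (List ℕ)}
    (hst : ∀ w ∈ c, IsStirlingWord w) (hcount : ∀ w ∈ c, ∀ v ∈ w, w.count v = 2)
    (hflat : ∀ v, c.flatten.count v ≤ 2) : IsStirlingWord (reversedCycleWord c) := by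
  induction c with
  | nil => exact fun i => i.elim0
  | cons w c ih =>
    have hadd : ∀ v, w.count v + c.flatten.count v ≤ 2 := fun v => by
      simpa [List.flatten_cons] using hflat v
    refine (hst w List.mem_cons_self).reverse.append
      (ih (fun u hu => hst u (List.mem_cons_of_mem _ hu))
        (fun u hu => hcount u (List.mem_cons_of_mem _ hu))
        fun v => (Nat.le_add_left _ _).trans (hadd v)) fun v hv hv' => ?_
    have h2 := hcount w List.mem_cons_self v (List.mem_reverse.1 hv)
    have h1 := List.count_pos_iff.2 ((reversedCycleWord_perm c).mem_iff.1 hv')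
    have := hadd v
    omega

theorem List.exists_eq_append_cons_notMem {a : ℕ} {l : List ℕ} (h : a ∈ l) :
    ∃ s t, l = s ++ a :: t ∧ a ∉ t := by
  obtain ⟨s, t, hl, hs⟩ := List.eq_append_cons_of_mem (List.mem_reverse.2 h)
  exact ⟨t.reverse, s.reverse, by simpa using congrArg List.reverse hl, by simpa using hs⟩

theorem exists_reversedCycleWord_eq (σ : List ℕ) (hst : IsStirlingWord σ)
    (hcount : ∀ v ∈ σ, σ.count v = 2) :
    ∃ c, reversedCycleWord c = σ ∧ IsStandardForm c ∧
      (∀ w ∈ c, IsStirlingWord w) ∧ ∀ w ∈ c, ∀ v ∈ w, w.count v = 2 := by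
  induction hlen : σ.length using Nat.strong_induction_on generalizing σ with
  | _ N ih =>
    by_cases hσ : σ = []
    · exact ⟨[], by simp [reversedCycleWord, hσ], by simp [IsStandardForm], by simp, by simp⟩
    obtain ⟨m, hm, hmin⟩ := σ.toFinset.exists_min_image id (by simpa using hσ)
    simp only [List.mem_toFinset, id] at hm hmin
    obtain ⟨s, t, rfl, ht⟩ := List.exists_eq_append_cons_notMem hm
    have hdisj : ∀ v ∈ s ++ [m], v ∉ t := by
      intro v hv hvt
      rcases List.mem_append.1 hv with hv | hv
      · have hsub : [v, m, v].Sublist (s ++ m :: t) :=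
          (List.singleton_sublist.2 hv).append ((List.singleton_sublist.2 hvt).cons_cons m)
        have := (isStirlingWord_iff_sublist _).1 hst v m hsub
        have := hmin v (by simp [hv])
        omega
      · exact ht (List.mem_singleton.1 hv ▸ hvt)
    have hadd : ∀ v, (s ++ m :: t).count v = (s ++ [m]).count v + t.count v := fun v => by
      rw [← List.count_append, List.append_assoc, List.singleton_append]
    obtain ⟨c, hc, hstd, hcst, hcc⟩ := ih t.length (by simp [← hlen]; omega) t
      (hst.sublist (by simp [List.sublist_append_of_sublist_right]))
      (fun v hv => by
        have := hcount v (by simp [hv])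
        rw [hadd, List.count_eq_zero_of_not_mem fun h => hdisj v h hv] at this
        omega) rfl
    have hrev : m :: s.reverse = (s ++ [m]).reverse := by simp
    refine ⟨(m :: s.reverse) :: c, by simp [hc], ⟨?_, ?_⟩, ?_, ?_⟩
    · rintro w (_ | ⟨_, hw⟩)
      · refine ⟨by simp, fun v hv => hmin v ?_⟩
        simp only [List.mem_cons, List.mem_reverse] at hv
        rcases hv with rfl | hv <;> simp [*]
      · exact hstd.1 w hw
    · refine List.pairwise_cons.2 ⟨fun w hw => ?_, hstd.2⟩
      have hwt : w.headI ∈ t := by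
        obtain ⟨a, l, rfl⟩ := List.exists_cons_of_ne_nil (hstd.1 w hw).1
        rw [← hc, (reversedCycleWord_perm c).mem_iff]
        exact List.mem_flatten.2 ⟨_, hw, by simp⟩
      exact lt_of_le_of_ne (hmin _ (by simp [hwt])) fun h => ht (by rwa [← h] at hwt)
    · rintro w (_ | ⟨_, hw⟩)
      · rw [hrev]
        exact (hst.sublist (by simp)).reverse
      · exact hcst w hw
    · rintro w (_ | ⟨_, hw⟩) v hv
      · rw [hrev, List.mem_reverse] at hv
        rw [hrev, List.count_reverse]
        have := hcount v (by simp at hv ⊢; tauto)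
        rwa [hadd, List.count_eq_zero_of_not_mem (hdisj v hv)] at this
      · exact hcc w hw v hv

theorem baseList_succ (n : ℕ) : baseList (n + 1) = baseList n ++ [n + 1, n + 1] := by
  simp [baseList, List.range_succ]

theorem length_baseList (n : ℕ) : (baseList n).length = 2 * n := by
  induction n with
  | zero => rfl
  | succ n ih => simp [baseList_succ, ih]; ring

theorem mem_baseList {n v : ℕ} : v ∈ baseList n ↔ 1 ≤ v ∧ v ≤ n := by
  simp only [baseList, List.mem_flatMap, List.mem_range, List.mem_cons, List.not_mem_nil,
    or_false, or_self]
  constructor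
  · rintro ⟨i, hi, rfl⟩; omega
  · rintro ⟨h1, h2⟩; exact ⟨v - 1, by omega, by omega⟩

theorem count_baseList {n v : ℕ} (h : v ∈ baseList n) : (baseList n).count v = 2 := by
  induction n with
  | zero => simp [baseList] at h
  | succ n ih =>
    rw [baseList_succ, List.count_append]
    by_cases hv : v ∈ baseList n
    · have := mem_baseList.1 hv
      rw [ih hv, List.count_eq_zero_of_not_mem]
      simp; omega
    · have hvn : v = n + 1 := by rw [mem_baseList] at h hv; omega
      rw [List.count_eq_zero_of_not_mem hv, hvn]
      simp

theorem mem_stirlingPerms {n : ℕ} {σ : List ℕ} :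
    σ ∈ stirlingPerms n ↔ σ.Perm (baseList n) ∧ IsStirlingWord σ := by
  simp [stirlingPerms, List.mem_permutations]

theorem mem_stirling2 {n : ℕ} {c : List (List ℕ)} : c ∈ stirling2 n ↔ IsStirling2 n c := by
  simp only [stirling2, Finset.mem_filter, and_iff_right_iff_imp]
  intro h
  have hlen : c.flatten.length = 2 * n := by rw [h.1.length_eq, length_baseList]
  have hpos : ∀ i ∈ c.map List.length, 0 < i := by
    intro i hi
    obtain ⟨w, hw, rfl⟩ := List.mem_map.1 hi
    exact List.length_pos_of_ne_nil (h.2.1 w hw).1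
  have hsum : (c.map List.length).sum = c.flatten.length := List.length_flatten.symm
  refine Finset.mem_image.2
    ⟨(c.flatten, ⟨c.map List.length, fun {i} => hpos i, hsum.trans hlen⟩), ?_, ?_⟩
  · simpa [List.mem_permutations] using h.1
  · exact List.splitWrtComposition_flatten c ⟨c.map List.length, fun {i} => hpos i, hsum⟩ rfl

theorem isStirling2_iff {n : ℕ} {c : List (List ℕ)} :
    IsStirling2 n c ↔ c.flatten.Perm (baseList n) ∧ IsStandardForm c ∧
      (∀ w ∈ c, IsStirlingWord w) ∧ ∀ w ∈ c, ∀ v ∈ w, w.count v = 2 := by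
  have : IsTrans (List ℕ) (fun w₁ w₂ => w₁.headI < w₂.headI) := ⟨fun _ _ _ => lt_trans⟩
  unfold IsStirling2 IsStandardForm
  change _ ∧ _ ∧ c.IsChain _ ↔ _
  rw [List.isChain_iff_pairwise]
  constructor
  · rintro ⟨h, hw, hc⟩
    exact ⟨h, ⟨fun w hwc => ⟨(hw w hwc).1, (hw w hwc).2.2.1⟩, hc⟩,
      fun w hwc => (hw w hwc).2.2.2, fun w hwc => (hw w hwc).2.1⟩
  · rintro ⟨h, ⟨hw, hc⟩, hs, h2⟩
    exact ⟨h, fun w hwc => ⟨(hw w hwc).1, h2 w hwc, (hw w hwc).2, hs w hwc⟩, hc⟩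

/-- For `n ≥ 1`:  `C_n(x) = ∑_{π ∈ Q_n²} x^{casc(π)+1}`; i.e. for each `k ≥ 1` the number
of Stirling permutations of the second kind of order `n` with `k-1` cycle ascents equals
the number of Stirling permutations of order `n` with `k` descents. -/
theorem stmt5 (n : ℕ) (hn : 1 ≤ n) :
    Cpoly n = ∑ σ ∈ stirling2 n, Polynomial.X ^ (casc σ + 1) := by
  symm
  refine Finset.sum_bij (fun c _ => reversedCycleWord c) ?_ ?_ ?_ ?_
  · intro c hc
    obtain ⟨hp, -, hst, h2⟩ := isStirling2_iff.1 (mem_stirling2.1 hc)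
    refine mem_stirlingPerms.2 ⟨(reversedCycleWord_perm c).trans hp,
      isStirlingWord_reversedCycleWord hst h2 fun v => ?_⟩
    rw [hp.count_eq]
    by_cases hv : v ∈ baseList n
    · exact (count_baseList hv).le
    · simp [List.count_eq_zero_of_not_mem hv]
  · intro c hc c' hc' h
    exact reversedCycleWord_injOn (isStirling2_iff.1 (mem_stirling2.1 hc)).2.1
      (isStirling2_iff.1 (mem_stirling2.1 hc')).2.1 h
  · intro σ hσ
    obtain ⟨hp, hst⟩ := mem_stirlingPerms.1 hσ
    obtain ⟨c, rfl, hc⟩ := exists_reversedCycleWord_eq σ hst fun v hv => by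
      rw [hp.count_eq, count_baseList (hp.mem_iff.1 hv)]
    exact ⟨c, mem_stirling2.2 (isStirling2_iff.2
      ⟨(reversedCycleWord_perm c).symm.trans hp, hc⟩), rfl⟩
  · intro c hc
    obtain ⟨hp, hstd, -⟩ := isStirling2_iff.1 (mem_stirling2.1 hc)
    have hne : c ≠ [] := by
      rintro rfl
      have := hp.length_eq
      rw [length_baseList] at this
      simp at this
      omega
    rw [desList_reversedCycleWord hstd fun v hv => ?_, if_neg hne]
    exact (mem_baseList.1 (hp.mem_iff.1 ((reversedCycleWord_perm c).mem_iff.1 hv))).1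
end
end
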